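/- For every k ∈ ℕ and every t ∈ (0,1] the following derivative formulas hold: (d/dt) X_k(t) = (1/t) Y_k(t) X_k(t), (d/dt) Y_k(t) = (1/t) Y_k(t) Z_k(t), and (d/dt) Z_k(t) = (1/(2t)) ( Z_k^2(t) + ∑_{i=1}^k Y_i^2(t) ). -/

import Mathlib

open MeasureTheory Real Set

noncomputable def X1 (t : ℝ) : ℝ := (1 - Real.log t)⁻¹

/-- Iterated logarithmic function: `XX 0 t = t`, `XX (k+1) t = X1 (XX k t)`;
so `XX 1 = X_1`, `XX 2 = X_2`, ... of the paper. -/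
noncomputable def XX : ℕ → ℝ → ℝ
  | 0, t => t
  | k + 1, t => X1 (XX k t)

/-- `YY k t = ∏_{i=1}^k X_i(t)`, with `YY 0 = 1`. -/
noncomputable def YY (k : ℕ) (t : ℝ) : ℝ := ∏ i ∈ Finset.Icc 1 k, XX i t

/-- `ZZ k t = ∑_{i=1}^k Y_i(t)`, with `ZZ 0 = 0`. -/
noncomputable def ZZ (k : ℕ) (t : ℝ) : ℝ := ∑ i ∈ Finset.Icc 1 k, YY i t

/-- The quantity `I_k[u; D]` of the paper. -/
noncomputable def Ik (n : ℕ) (p D : ℝ) (Ω : Set (EuclideanSpace ℝ (Fin n))) (k : ℕ)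
    (u : EuclideanSpace ℝ (Fin n) → ℝ) : ℝ :=
  (∫ x in Ω, ‖fderiv ℝ u x‖ ^ p)
    - |((n : ℝ) - p) / p| ^ p * ∫ x in Ω, |u x| ^ p / ‖x‖ ^ p
    - ((p - 1) / (2 * p)) * |((n : ℝ) - p) / p| ^ (p - 2) *
        ∫ x in Ω, (|u x| ^ p / ‖x‖ ^ p) * ∑ i ∈ Finset.Icc 1 k, (YY i (‖x‖ / D)) ^ 2

theorem XX_mem_Ioc (k : ℕ) {t : ℝ} (ht : t ∈ Set.Ioc (0 : ℝ) 1) :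
    XX k t ∈ Set.Ioc (0 : ℝ) 1 := by
  induction k with
  | zero => exact ht
  | succ k ih =>
    have hlog : Real.log (XX k t) ≤ 0 := Real.log_nonpos ih.1.le ih.2
    exact ⟨inv_pos.2 (by linarith), inv_le_one_of_one_le₀ (by linarith)⟩

theorem YY_succ (k : ℕ) (t : ℝ) : YY (k + 1) t = YY k t * XX (k + 1) t :=
  Finset.prod_Icc_succ_top (Nat.le_add_left 1 k) _

theorem ZZ_succ (k : ℕ) (t : ℝ) : ZZ (k + 1) t = ZZ k t + YY (k + 1) t :=
  Finset.sum_Icc_succ_top (Nat.le_add_left 1 k) _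

theorem hasDerivAt_X1 {x : ℝ} (hx : x ∈ Set.Ioc (0 : ℝ) 1) :
    HasDerivAt X1 (X1 x ^ 2 / x) x := by
  have hne : 1 - Real.log x ≠ 0 := by
    linarith [Real.log_nonpos hx.1.le hx.2]
  refine (((Real.hasDerivAt_log hx.1.ne').const_sub 1).fun_inv hne).congr_deriv ?_
  simp only [X1, neg_neg, inv_pow, div_eq_mul_inv]
  ring

theorem hasDerivAt_XX (k : ℕ) {t : ℝ} (ht : t ∈ Set.Ioc (0 : ℝ) 1) :
    HasDerivAt (XX k) ((1 / t) * YY k t * XX k t) t := by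
  induction k with
  | zero =>
    refine (hasDerivAt_id t).congr_deriv ?_
    simp [YY, XX, ht.1.ne']
  | succ k ih =>
    have hX := XX_mem_Ioc k ht
    refine ((hasDerivAt_X1 hX).comp t ih).congr_deriv ?_
    have hne := hX.1.ne'
    have ht0 := ht.1.ne'
    rw [YY_succ, show XX (k + 1) t = X1 (XX k t) from rfl]
    field_simp

theorem hasDerivAt_YY (k : ℕ) {t : ℝ} (ht : t ∈ Set.Ioc (0 : ℝ) 1) :
    HasDerivAt (YY k) ((1 / t) * YY k t * ZZ k t) t := by
  induction k with
  | zero =>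
    have h0 : YY 0 = fun _ => 1 := by ext; simp [YY]
    simpa [h0, ZZ] using hasDerivAt_const t (1 : ℝ)
  | succ k ih =>
    rw [funext (YY_succ k)]
    refine (ih.fun_mul (hasDerivAt_XX (k + 1) ht)).congr_deriv ?_
    rw [ZZ_succ, YY_succ]
    ring

theorem hasDerivAt_ZZ (k : ℕ) {t : ℝ} (ht : t ∈ Set.Ioc (0 : ℝ) 1) :
    HasDerivAt (ZZ k)
      ((1 / (2 * t)) * ((ZZ k t) ^ 2 + ∑ i ∈ Finset.Icc 1 k, (YY i t) ^ 2)) t := by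
  induction k with
  | zero =>
    have h0 : ZZ 0 = fun _ => 0 := by ext; simp [ZZ]
    simpa [h0] using hasDerivAt_const t (0 : ℝ)
  | succ k ih =>
    rw [funext (ZZ_succ k)]
    refine (ih.fun_add (hasDerivAt_YY (k + 1) ht)).congr_deriv ?_
    rw [Finset.sum_Icc_succ_top (Nat.le_add_left 1 k), ZZ_succ]
    have ht0 := ht.1.ne'
    field_simp
    ring

/-- Derivative formulas for `X_k`, `Y_k`, `Z_k` on `(0,1]` (one-sided at `t = 1`). -/
theorem deriv_XYZ (k : ℕ) (hk : 1 ≤ k) (t : ℝ) (ht : t ∈ Set.Ioc (0 : ℝ) 1) :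
    HasDerivWithinAt (XX k) ((1 / t) * YY k t * XX k t) (Set.Ioc (0 : ℝ) 1) t ∧
    HasDerivWithinAt (YY k) ((1 / t) * YY k t * ZZ k t) (Set.Ioc (0 : ℝ) 1) t ∧
    HasDerivWithinAt (ZZ k)
      ((1 / (2 * t)) * ((ZZ k t) ^ 2 + ∑ i ∈ Finset.Icc 1 k, (YY i t) ^ 2))
      (Set.Ioc (0 : ℝ) 1) t := by
  exact ⟨(hasDerivAt_XX k ht).hasDerivWithinAt, (hasDerivAt_YY k ht).hasDerivWithinAt,
    (hasDerivAt_ZZ k ht).hasDerivWithinAt⟩
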